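/- arXiv:0902.2235 — 2 statements merged into one kernel-verified Lean document; each statement's English description precedes it below -/
import Mathlib

section
/- Strongly isometric convolutional codes share the same weight enumerator: if C, C̄ ⊆ F[z]^n are convolutional codes and φ : C → C̄ is a strong isometry, then for every d ∈ ℕ₀ and every w ∈ ℕ the number of atomic codewords of C of degree d and weight w equals the number of atomic codewords of C̄ of degree d and weight w. -/
open Matrix Polynomial

variable {F : Type*} [Field F]

/-- The weight of a polynomial row vector: the total number of nonzero
coefficients occurring in its entries. -/
def wtP {n : ℕ} (v : Fin n → Polynomial F) : ℕ := ∑ i, (v i).support.card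

/-- The degree of a polynomial row vector: the maximal degree of its entries. -/
def degP {n : ℕ} (v : Fin n → Polynomial F) : ℕ := Finset.univ.sup fun i => (v i).natDegree

/-- The delay of a polynomial row vector: the least `t` such that the `t`-th
coefficient vector is nonzero. -/
noncomputable def delP {n : ℕ} (v : Fin n → Polynomial F) : ℕ :=
  sInf {t : ℕ | ∃ i, (v i).coeff t ≠ 0}

/-- A polynomial matrix is basic if its evaluation at every point of the algebraic
closure has full row rank. -/
def IsBasic {k n : ℕ} (G : Matrix (Fin k) (Fin n) (Polynomial F)) : Prop :=
  ∀ lam : AlgebraicClosure F, (G.map fun p => (Polynomial.aeval lam) p).rank = k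

/-- The set of codewords generated by the encoder `G`. -/
def codeOf {k n : ℕ} (G : Matrix (Fin k) (Fin n) (Polynomial F)) :
    Set (Fin n → Polynomial F) :=
  Set.range fun u : Fin k → Polynomial F => u ᵥ* G

/-- A convolutional code of length `n`: a submodule of `F[z]^n` generated by some
basic matrix. -/
def IsConvCode {n : ℕ} (C : Submodule (Polynomial F) (Fin n → Polynomial F)) : Prop :=
  ∃ (k : ℕ) (G : Matrix (Fin k) (Fin n) (Polynomial F)),
    IsBasic G ∧ (C : Set (Fin n → Polynomial F)) = codeOf G

/-- Atomicity of a codeword `v` of a code (given as a set) `S`. -/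
def IsAtomicCW {n : ℕ} (S : Set (Fin n → Polynomial F)) (v : Fin n → Polynomial F) : Prop :=
  v ≠ 0 ∧ (∃ i, (v i).coeff 0 ≠ 0) ∧
    ∀ (L : ℕ) (vh vt : Fin n → Polynomial F), vh ∈ S → vt ∈ S → vh ≠ 0 → vt ≠ 0 →
      degP vh ≤ L → (∀ i, ∀ t ≤ L, (vt i).coeff t = 0) → v ≠ vh + vt


/-- The rows of a basic matrix are linearly independent at every point. -/
theorem IsBasic.vecMul_injective {k n : ℕ} {G : Matrix (Fin k) (Fin n) (Polynomial F)}
    (hG : IsBasic G) (lam : AlgebraicClosure F) :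
    Function.Injective fun x => x ᵥ* G.map fun p => (Polynomial.aeval lam) p := by
  rw [Matrix.vecMul_injective_iff, linearIndependent_iff_card_eq_finrank_span, Fintype.card_fin,
    Set.finrank, ← Matrix.rank_eq_finrank_span_row, hG lam]

/-- A convolutional code is saturated with respect to the indeterminate. -/
theorem IsConvCode.mem_of_X_smul_mem {n : ℕ}
    {C : Submodule (Polynomial F) (Fin n → Polynomial F)} (hC : IsConvCode C)
    {v : Fin n → Polynomial F} (hv : (X : Polynomial F) • v ∈ C) : v ∈ C := by
  obtain ⟨k, G, hG, hCG⟩ := hC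
  have mem_iff (x : Fin n → Polynomial F) : x ∈ C ↔ ∃ u, u ᵥ* G = x := by
    rw [← SetLike.mem_coe, hCG]
    rfl
  obtain ⟨u, hu⟩ := (mem_iff _).1 hv
  have hu0 : (fun i => aeval (0 : AlgebraicClosure F) (u i)) = 0 := by
    refine hG.vecMul_injective 0 ?_
    funext j
    have := congrArg (aeval (0 : AlgebraicClosure F)) (congrFun hu j)
    simpa [Matrix.vecMul, dotProduct] using this
  have hdvd (i : Fin k) : X ∣ u i := by
    rw [X_dvd_iff]
    refine (algebraMap F (AlgebraicClosure F)).injective ?_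
    rw [coeff_zero_eq_aeval_zero', map_zero]
    exact congrFun hu0 i
  choose u' hu' using hdvd
  obtain rfl : u = (X : Polynomial F) • u' := funext hu'
  rw [Matrix.smul_vecMul] at hu
  exact (mem_iff v).2 ⟨u', smul_right_injective _ X_ne_zero hu⟩

theorem IsConvCode.mem_of_X_pow_smul_mem {n : ℕ}
    {C : Submodule (Polynomial F) (Fin n → Polynomial F)} (hC : IsConvCode C)
    {v : Fin n → Polynomial F} (m : ℕ) (hv : (X ^ m : Polynomial F) • v ∈ C) : v ∈ C := by
  induction m with
  | zero => simpa using hv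
  | succ m ih =>
    rw [pow_succ', mul_smul] at hv
    exact ih (hC.mem_of_X_smul_mem hv)

/-- Module homomorphisms from a convolutional code do not decrease the delay. -/
theorem IsConvCode.coeff_map_eq_zero {n : ℕ}
    {C Cbar : Submodule (Polynomial F) (Fin n → Polynomial F)} (hC : IsConvCode C)
    (φ : C →ₗ[Polynomial F] Cbar) (v : C) (L : ℕ)
    (hv : ∀ i, ∀ t ≤ L, ((v : Fin n → Polynomial F) i).coeff t = 0) (i : Fin n) (t : ℕ)
    (ht : t ≤ L) : ((φ v : Fin n → Polynomial F) i).coeff t = 0 := by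
  obtain ⟨v, hvC⟩ := v
  have hdvd (i : Fin n) : X ^ (L + 1) ∣ v i :=
    X_pow_dvd_iff.2 fun t ht => hv i t (Nat.lt_succ_iff.1 ht)
  choose u hu using hdvd
  obtain rfl : v = (X ^ (L + 1) : Polynomial F) • u := funext hu
  have huC := hC.mem_of_X_pow_smul_mem (L + 1) hvC
  have hφ : φ ⟨_, hvC⟩ = (X ^ (L + 1) : Polynomial F) • φ ⟨u, huC⟩ := by
    rw [← map_smul]
    rfl
  rw [hφ]
  exact X_pow_dvd_iff.1 (dvd_mul_right _ _) t (Nat.lt_succ_iff.2 ht)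

/-- A degree-preserving isomorphism of convolutional codes preserves atomic codewords. -/
theorem IsAtomicCW.map_linearEquiv {n : ℕ}
    {C Cbar : Submodule (Polynomial F) (Fin n → Polynomial F)}
    (hCbar : IsConvCode Cbar) (φ : C ≃ₗ[Polynomial F] Cbar)
    (hdeg : ∀ v : C, (v : Fin n → Polynomial F) ≠ 0 →
      degP ((φ v : Fin n → Polynomial F)) = degP (v : Fin n → Polynomial F))
    {v : C} (hv : IsAtomicCW (C : Set (Fin n → Polynomial F)) v) :
    IsAtomicCW (Cbar : Set (Fin n → Polynomial F)) (φ v) := by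
  obtain ⟨hv0, ⟨i, hi⟩, hsplit⟩ := hv
  refine ⟨by simpa using hv0, ?_, ?_⟩
  · by_contra! h
    refine hi ?_
    simpa using hCbar.coeff_map_eq_zero (φ.symm : Cbar →ₗ[Polynomial F] C) (φ v) 0
      (fun j t ht => by rw [Nat.le_zero.1 ht]; exact h j) i 0 le_rfl
  · intro L vh vt hh ht hh0 ht0 hdegh hcoeff heq
    have hsymm0 (x : Cbar) (hx : (x : Fin n → Polynomial F) ≠ 0) :
        (φ.symm x : Fin n → Polynomial F) ≠ 0 := by
      simpa using hx
    refine hsplit L (φ.symm ⟨vh, hh⟩) (φ.symm ⟨vt, ht⟩) (φ.symm ⟨vh, hh⟩).2 (φ.symm ⟨vt, ht⟩).2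
      (hsymm0 _ hh0) (hsymm0 _ ht0) ?_ ?_ ?_
    · rw [← hdeg _ (hsymm0 _ hh0)]
      simpa using hdegh
    · exact hCbar.coeff_map_eq_zero (φ.symm : Cbar →ₗ[Polynomial F] C) ⟨vt, ht⟩ L hcoeff
    · have : φ v = ⟨vh, hh⟩ + ⟨vt, ht⟩ := Subtype.ext heq
      rw [← Submodule.coe_add, ← map_add, ← this, φ.symm_apply_apply]

/-- Strongly isometric convolutional codes share the same weight enumerator:
for every degree and weight, they have the same number of atomic codewords
of that degree and weight. -/
theorem stmt8 {F : Type*} [Field F] [Fintype F] {n : ℕ}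
    (C Cbar : Submodule (Polynomial F) (Fin n → Polynomial F))
    (hC : IsConvCode C) (hCbar : IsConvCode Cbar)
    (φ : C ≃ₗ[Polynomial F] Cbar)
    (hwt : ∀ v : C, wtP ((φ v : Fin n → Polynomial F)) = wtP (v : Fin n → Polynomial F))
    (hdeg : ∀ v : C, (v : Fin n → Polynomial F) ≠ 0 →
      degP ((φ v : Fin n → Polynomial F)) = degP (v : Fin n → Polynomial F)) :
    ∀ (d : ℕ) (w : ℕ),
      {v : Fin n → Polynomial F | v ∈ C ∧ IsAtomicCW (C : Set (Fin n → Polynomial F)) v ∧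
        degP v = d ∧ wtP v = w}.ncard
      = {v : Fin n → Polynomial F | v ∈ Cbar ∧
          IsAtomicCW (Cbar : Set (Fin n → Polynomial F)) v ∧ degP v = d ∧ wtP v = w}.ncard := by
  intro d w
  have hwt' (v : Cbar) :
      wtP (φ.symm v : Fin n → Polynomial F) = wtP (v : Fin n → Polynomial F) := by
    simpa using (hwt (φ.symm v)).symm
  have hdeg' (v : Cbar) (hv : (v : Fin n → Polynomial F) ≠ 0) :
      degP (φ.symm v : Fin n → Polynomial F) = degP (v : Fin n → Polynomial F) := by
    simpa using (hdeg (φ.symm v) (by simpa using hv)).symm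
  refine Set.ncard_congr (fun v hv => φ ⟨v, hv.1⟩) ?_ ?_ ?_
  · rintro v ⟨hvC, hat, hd, hw⟩
    exact ⟨(φ ⟨v, hvC⟩).2, IsAtomicCW.map_linearEquiv hCbar φ hdeg hat,
      (hdeg _ hat.1).trans hd, (hwt _).trans hw⟩
  · intro u v hu hv huv
    exact congrArg Subtype.val (φ.injective (Subtype.ext huv))
  · rintro v ⟨hvC, hat, hd, hw⟩
    refine ⟨φ.symm ⟨v, hvC⟩, ⟨(φ.symm ⟨v, hvC⟩).2,
      IsAtomicCW.map_linearEquiv hC φ.symm hdeg' hat, (hdeg' _ hat.1).trans hd,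
      (hwt' _).trans hw⟩, ?_⟩
    simp
end

section
/- The weight adjacency matrix of a convolutional code is unique up to a state space isomorphism: let C ⊆ F[z]^n be a convolutional code of degree δ and let G and Ḡ be any two basic reduced encoders of C (so im G = im Ḡ = C), with CCFs (A,B,C,D) and (Ā,B̄,C̄,D̄) respectively. Then there exists an invertible matrix T ∈ GL_δ(F) such that Λ(G)_{X,Y} = Λ(Ḡ)_{XT,YT} for all X, Y ∈ F^δ; that is, for all X, Y ∈ F^δ and every w ∈ ℕ₀, the number of u ∈ F^k with Y = XA + uB and wt(XC + uD) = w equals the number of u ∈ F^k with YT = (XT)Ā + uB̄ and wt((XT)C̄ + uD̄) = w. -/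
open Matrix Polynomial

variable {F : Type*} [Field F]

/-- The `i`-th row degree of a polynomial matrix. -/
def rowDeg {k n : ℕ} (G : Matrix (Fin k) (Fin n) (Polynomial F)) (i : Fin k) : ℕ :=
  Finset.univ.sup fun j => (G i j).natDegree

/-- The (internal) degree of a polynomial matrix: the maximal degree of its `k × k` minors. -/
noncomputable def degMat {k n : ℕ} (G : Matrix (Fin k) (Fin n) (Polynomial F)) : ℕ :=
  Finset.univ.sup fun f : Fin k ↪ Fin n => (Matrix.det fun i i' => G i (f i')).natDegree

/-- A polynomial matrix is reduced if the sum of its row degrees equals its degree. -/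
noncomputable def IsRowReduced {k n : ℕ} (G : Matrix (Fin k) (Fin n) (Polynomial F)) : Prop :=
  (∑ i, rowDeg G i) = degMat G

/-- Index set for the state space of the controller canonical form with row degrees `ν`. -/
abbrev StateIdx {k : ℕ} (ν : Fin k → ℕ) := (i : Fin k) × Fin (ν i)

/-- The matrix `A` of the controller canonical form. -/
def ccfA {k : ℕ} (ν : Fin k → ℕ) : Matrix (StateIdx ν) (StateIdx ν) F :=
  fun p q => if p.1 = q.1 ∧ (q.2 : ℕ) = (p.2 : ℕ) + 1 then 1 else 0

/-- The matrix `B` of the controller canonical form. -/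
def ccfB {k : ℕ} (ν : Fin k → ℕ) : Matrix (Fin k) (StateIdx ν) F :=
  fun i q => if i = q.1 ∧ (q.2 : ℕ) = 0 then 1 else 0

/-- The matrix `C` of the controller canonical form of `G`. -/
def ccfC {k n : ℕ} (G : Matrix (Fin k) (Fin n) (Polynomial F)) :
    Matrix (StateIdx (rowDeg G)) (Fin n) F :=
  fun p j => (G p.1 j).coeff ((p.2 : ℕ) + 1)

/-- The matrix `D` of the controller canonical form of `G`. -/
def ccfD {k n : ℕ} (G : Matrix (Fin k) (Fin n) (Polynomial F)) :
    Matrix (Fin k) (Fin n) F :=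
  fun i j => (G i j).coeff 0

/-- The entry of the weight adjacency matrix of `G` at the pair of states `(X, Y)`:
the coefficient of `W^w` is the number of inputs `u` realizing the state transition
`X → Y` whose corresponding output has Hamming weight `w`. -/
noncomputable def WAMe {k n : ℕ} [DecidableEq F] (G : Matrix (Fin k) (Fin n) (Polynomial F))
    (X Y : StateIdx (rowDeg G) → F) (w : ℕ) : ℕ :=
  Set.ncard {u : Fin k → F |
    X ᵥ* ccfA (rowDeg G) + u ᵥ* ccfB (rowDeg G) = Y ∧
    hammingNorm (X ᵥ* ccfC G + u ᵥ* ccfD G) = w}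

/-- The coefficients of a row of `G` at its row degree. -/
def leadingRows {k n : ℕ} (G : Matrix (Fin k) (Fin n) (Polynomial F)) :
    Matrix (Fin k) (Fin n) F :=
  fun i j => (G i j).coeff (rowDeg G i)

/-- The left kernel of the leading coefficient matrix is trivial. -/
def HasIndepLeadingRows {k n : ℕ} (G : Matrix (Fin k) (Fin n) (Polynomial F)) : Prop :=
  ∀ a : Fin k → F, a ᵥ* leadingRows G = 0 → a = 0

lemma natDegree_le_rowDeg {k n : ℕ} (G : Matrix (Fin k) (Fin n) (Polynomial F))
    (i : Fin k) (j : Fin n) : (G i j).natDegree ≤ rowDeg G i :=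
  Finset.le_sup (f := fun j => (G i j).natDegree) (Finset.mem_univ j)

lemma coeff_prod_sum_of_natDegree_le {ι : Type*} (s : Finset ι) (f : ι → F[X]) (d : ι → ℕ)
    (h : ∀ i, (f i).natDegree ≤ d i) :
    (∏ i ∈ s, f i).coeff (∑ i ∈ s, d i) = ∏ i ∈ s, (f i).coeff (d i) := by
  classical
  induction s using Finset.induction_on with
  | empty => simp
  | insert a s ha ih =>
    rw [Finset.prod_insert ha, Finset.sum_insert ha, Finset.prod_insert ha,
      coeff_mul_add_eq_of_natDegree_le (h a), ih]
    exact (natDegree_prod_le _ _).trans (Finset.sum_le_sum fun i _ => h i)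

lemma coeff_det_sum_of_natDegree_le {k : ℕ} (M : Matrix (Fin k) (Fin k) F[X]) (d : Fin k → ℕ)
    (h : ∀ i j, (M i j).natDegree ≤ d i) :
    M.det.coeff (∑ i, d i) = (Matrix.of fun i j => (M i j).coeff (d i)).det := by
  rw [← Matrix.det_transpose M, ← Matrix.det_transpose (Matrix.of _), Matrix.det_apply',
    Matrix.det_apply', finsetSum_coeff]
  refine Finset.sum_congr rfl fun σ _ => ?_
  rw [← C_eq_intCast, coeff_C_mul]
  congr 1
  exact coeff_prod_sum_of_natDegree_le _ (fun i => M i (σ i)) d fun i => h i (σ i)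

lemma hasIndepLeadingRows_of_isBasic {k n : ℕ} {G : Matrix (Fin k) (Fin n) (Polynomial F)}
    (hG : IsBasic G) (hred : IsRowReduced G) : HasIndepLeadingRows G := by
  intro a ha
  by_cases h0 : degMat G = 0
  · have hν : ∀ i, rowDeg G i = 0 := by
      have : ∑ i, rowDeg G i = 0 := hred.trans h0
      simpa using this
    have hmap : (G.map fun p => (aeval (0 : AlgebraicClosure F)) p)
        = (leadingRows G).map (algebraMap F (AlgebraicClosure F)) := by
      ext i j
      have : (G i j).natDegree = 0 := Nat.le_zero.1 ((hν i) ▸ natDegree_le_rowDeg G i j)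
      rw [Matrix.map_apply, Matrix.map_apply, leadingRows, hν i]
      conv_lhs => rw [eq_C_of_natDegree_eq_zero this]
      simp
    have hr := hG 0
    rw [hmap] at hr
    rw [Matrix.rank_eq_finrank_span_row] at hr
    have hli : LinearIndependent (AlgebraicClosure F)
        ((leadingRows G).map (algebraMap F (AlgebraicClosure F))).row :=
      linearIndependent_iff_card_eq_finrank_span.2 (by rw [Fintype.card_fin]; exact hr.symm)
    have hinj := Matrix.vecMul_injective_iff.2 hli
    have hz : (fun i => algebraMap F (AlgebraicClosure F) (a i)) = 0 := by
      apply hinj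
      ext j
      have := congrArg (algebraMap F (AlgebraicClosure F)) (congrFun ha j)
      simpa [Matrix.vecMul, dotProduct] using this
    ext i
    simpa using congrFun hz i
  · have hne : (Finset.univ : Finset (Fin k ↪ Fin n)).Nonempty := by
      by_contra hcon
      rw [Finset.not_nonempty_iff_eq_empty] at hcon
      exact h0 (by rw [degMat, hcon]; rfl)
    obtain ⟨f, -, hf⟩ := Finset.exists_mem_eq_sup _ hne
      fun f : Fin k ↪ Fin n => (Matrix.det fun i i' => G i (f i')).natDegree
    have hf' : ∑ i, rowDeg G i = (Matrix.det fun i i' => G i (f i')).natDegree := hred.trans hf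
    have hdet := coeff_det_sum_of_natDegree_le (fun i i' => G i (f i')) (rowDeg G)
      fun i j => natDegree_le_rowDeg G i (f j)
    refine Matrix.eq_zero_of_vecMul_eq_zero
      (M := Matrix.of fun i i' => (G i (f i')).coeff (rowDeg G i)) ?_ ?_
    · rw [← hdet, hf', coeff_natDegree, Ne, leadingCoeff_eq_zero]
      intro hzero
      apply h0
      rw [← hred, hf', hzero, natDegree_zero]
    · ext j
      exact congrFun ha (f j)

/-- The predictable degree property, for row vectors all of whose coefficients in degrees
`≥ d` vanish after multiplication by `G`. -/
lemma coeff_eq_zero_of_coeff_vecMul_eq_zero {k n : ℕ}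
    {G : Matrix (Fin k) (Fin n) (Polynomial F)}
    (hG : HasIndepLeadingRows G) (y : Fin k → F[X]) (d : ℕ)
    (h : ∀ j t, d ≤ t → ((y ᵥ* G) j).coeff t = 0) (i : Fin k) (s : ℕ)
    (hs : d ≤ s + rowDeg G i) : (y i).coeff s = 0 := by
  obtain ⟨M, hM⟩ : ∃ M, ∀ i, (y i).natDegree + rowDeg G i < M :=
    ⟨(∑ i, ((y i).natDegree + rowDeg G i)) + 1, fun i => Nat.lt_succ_of_le
      (Finset.single_le_sum (f := fun i => (y i).natDegree + rowDeg G i)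
        (fun _ _ => Nat.zero_le _) (Finset.mem_univ i))⟩
  suffices key : ∀ e i s, d ≤ s + rowDeg G i → M ≤ s + rowDeg G i + e → (y i).coeff s = 0 from
    key M i s hs (Nat.le_add_left _ _)
  intro e
  induction e with
  | zero =>
    intro i s _ h2
    exact coeff_eq_zero_of_natDegree_lt (by have := hM i; omega)
  | succ e ih =>
    intro i s h1 h2
    by_cases h3 : M ≤ s + rowDeg G i + e
    · exact ih i s h1 h3
    set t := s + rowDeg G i with ht
    have hterm : ∀ i' j, (y i' * G i' j).coeff t =
        (if rowDeg G i' ≤ t then (y i').coeff (t - rowDeg G i') else 0) * leadingRows G i' j := by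
      intro i' j
      have hvan : ∀ x ∈ Finset.HasAntidiagonal.antidiagonal t, x.2 ≠ rowDeg G i' →
          (y i').coeff x.1 * (G i' j).coeff x.2 = 0 := by
        intro x hx hne
        rw [Finset.HasAntidiagonal.mem_antidiagonal] at hx
        rcases lt_or_gt_of_ne hne with hlt | hgt
        · rw [ih i' x.1 (by omega) (by omega), zero_mul]
        · rw [coeff_eq_zero_of_natDegree_lt ((natDegree_le_rowDeg G i' j).trans_lt hgt), mul_zero]
      rw [coeff_mul]
      split_ifs with hle
      · rw [Finset.sum_eq_single_of_mem (t - rowDeg G i', rowDeg G i')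
          (by rw [Finset.HasAntidiagonal.mem_antidiagonal]; exact Nat.sub_add_cancel hle)]
        · rfl
        · intro x hx hne
          refine hvan x hx fun hx2 => hne ?_
          rw [Finset.HasAntidiagonal.mem_antidiagonal] at hx
          ext <;> simp only <;> omega
      · rw [zero_mul]
        refine Finset.sum_eq_zero fun x hx => hvan x hx ?_
        rw [Finset.HasAntidiagonal.mem_antidiagonal] at hx
        omega
    have hzero := hG (fun i' => if rowDeg G i' ≤ t then (y i').coeff (t - rowDeg G i') else 0) (by
      ext j
      have := h j t h1
      rw [Matrix.vecMul, dotProduct, finsetSum_coeff] at this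
      simp only [hterm] at this
      exact this)
    have := congrFun hzero i
    simpa [ht] using this

/-- The zero-input output of the controller canonical form of `G` started in the state `X`. -/
noncomputable def freeOutput {k n : ℕ} (G : Matrix (Fin k) (Fin n) (Polynomial F)) :
    (StateIdx (rowDeg G) → F) →ₗ[F] (Fin n → F[X]) :=
  Fintype.linearCombination F fun p j => divX^[(p.2 : ℕ) + 1] (G p.1 j)

lemma coeff_iterate_divX (m : ℕ) (f : F[X]) (t : ℕ) :
    (divX^[m] f).coeff t = f.coeff (t + m) := by
  induction m generalizing f with
  | zero => rfl
  | succ m ih => rw [Function.iterate_succ_apply, ih, coeff_divX, add_assoc]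

lemma coeff_freeOutput {k n : ℕ} (G : Matrix (Fin k) (Fin n) (Polynomial F))
    (x : StateIdx (rowDeg G) → F) (j : Fin n) (t : ℕ) :
    (freeOutput G x j).coeff t = ∑ p, x p * (G p.1 j).coeff (t + (p.2 + 1)) := by
  simp [freeOutput, Fintype.linearCombination_apply, coeff_iterate_divX, add_assoc]

/-- The output of the controller canonical form of `G` started in a given state and driven by
a given polynomial input. -/
noncomputable def output {k n : ℕ} (G : Matrix (Fin k) (Fin n) (Polynomial F)) :
    ((StateIdx (rowDeg G) → F) × (Fin k → F[X])) →ₗ[F] (Fin n → F[X]) :=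
  (freeOutput G).coprod ((Matrix.vecMulLinear G).restrictScalars F)

lemma output_apply {k n : ℕ} (G : Matrix (Fin k) (Fin n) (Polynomial F))
    (x : StateIdx (rowDeg G) → F) (u : Fin k → F[X]) :
    output G (x, u) = freeOutput G x + u ᵥ* G := rfl

/-- Observability: a reduced encoder distinguishes states, even modulo the code. -/
lemma output_injective {k n : ℕ} {G : Matrix (Fin k) (Fin n) (Polynomial F)}
    (hG : HasIndepLeadingRows G) : Function.Injective (output G) := by
  rw [← LinearMap.ker_eq_bot, LinearMap.ker_eq_bot']
  rintro ⟨x, u⟩ hxu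
  obtain ⟨N, hN⟩ : ∃ N, ∀ i, rowDeg G i ≤ N :=
    ⟨_, fun i => Finset.le_sup (f := rowDeg G) (Finset.mem_univ i)⟩
  set y : Fin k → F[X] := fun i =>
    X ^ N * u i + ∑ l : Fin (rowDeg G i), monomial (N - 1 - l) (x ⟨i, l⟩) with hy
  have hcoeff : ∀ j t, N ≤ t → ((y ᵥ* G) j).coeff t = 0 := by
    intro j t ht
    obtain ⟨s, rfl⟩ := Nat.exists_eq_add_of_le' ht
    have h0 := congrArg (fun v => (v j).coeff s) hxu
    simp only [output_apply, Pi.add_apply, coeff_add, coeff_freeOutput, Matrix.vecMul, dotProduct,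
      finsetSum_coeff, Fintype.sum_sigma, ← Finset.sum_add_distrib, Pi.zero_apply,
      coeff_zero] at h0
    rw [← h0, Matrix.vecMul, dotProduct, finsetSum_coeff]
    refine Finset.sum_congr rfl fun i _ => ?_
    rw [hy, add_mul, coeff_add, mul_assoc, coeff_X_pow_mul, add_comm, Finset.sum_mul,
      finsetSum_coeff]
    congr 1
    refine Finset.sum_congr rfl fun l _ => ?_
    have := hN i
    have := l.2
    rw [show s + N = s + (l + 1) + (N - 1 - l) by omega, coeff_monomial_mul]
  have hvan := coeff_eq_zero_of_coeff_vecMul_eq_zero hG y N hcoeff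
  ext1
  · ext ⟨i, l⟩
    have hl := l.2
    have hi := hN i
    have := hvan i (N - 1 - l) (by omega)
    rw [hy, coeff_add, coeff_X_pow_mul', if_neg (by omega), zero_add, finsetSum_coeff,
      Finset.sum_eq_single l, coeff_monomial, if_pos rfl] at this
    · exact this
    · intro l' _ hne
      have := l'.2
      rw [coeff_monomial, if_neg]
      intro h
      exact hne (Fin.ext (by omega))
    · simp
  · ext i s
    have hi := hN i
    have := hvan i (s + N) (by omega)
    rw [hy, coeff_add, coeff_X_pow_mul, finsetSum_coeff, Finset.sum_eq_zero, add_zero] at this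
    · exact this
    · intro l _
      have := l.2
      rw [coeff_monomial, if_neg (by omega)]

lemma sum_ite_mul_coeff {k n : ℕ} (G : Matrix (Fin k) (Fin n) (Polynomial F))
    (i : Fin k) (m t : ℕ) (j : Fin n) :
    ∑ q : StateIdx (rowDeg G), (if i = q.1 ∧ (q.2 : ℕ) = m then (1 : F) else 0) *
      (G q.1 j).coeff (t + (q.2 + 1)) = (G i j).coeff (t + (m + 1)) := by
  by_cases hm : m < rowDeg G i
  · rw [Finset.sum_eq_single ⟨i, ⟨m, hm⟩⟩]
    · simp
    · rintro ⟨i', l⟩ _ hne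
      rw [if_neg, zero_mul]
      rintro ⟨h, hl⟩
      dsimp only at h hl
      subst h
      subst hl
      exact hne rfl
    · simp
  · rw [coeff_eq_zero_of_natDegree_lt ((natDegree_le_rowDeg G i j).trans_lt (by omega))]
    refine Finset.sum_eq_zero ?_
    rintro ⟨i', l⟩ _
    rw [if_neg, zero_mul]
    rintro ⟨h, hl⟩
    dsimp only at h hl
    subst h
    have := l.2
    omega

/-- The first step of a trajectory of the controller canonical form. -/
lemma output_eq_step {k n : ℕ} (G : Matrix (Fin k) (Fin n) (Polynomial F))
    (x : StateIdx (rowDeg G) → F) (u : Fin k → F[X]) (j : Fin n) :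
    output G (x, u) j =
      X * output G (x ᵥ* ccfA (rowDeg G) + (fun i => (u i).coeff 0) ᵥ* ccfB (rowDeg G),
        fun i => divX (u i)) j +
      C ((x ᵥ* ccfC G + (fun i => (u i).coeff 0) ᵥ* ccfD G) j) := by
  ext t
  rcases t with _ | t
  · simp [output_apply, coeff_freeOutput, Matrix.vecMul, dotProduct,
      mul_coeff_zero, ccfC, ccfD]
  · rw [coeff_add, coeff_C_succ, add_zero, coeff_X_mul]
    have hA : ∑ q, (x ᵥ* ccfA (rowDeg G)) q * (G q.1 j).coeff (t + (q.2 + 1)) =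
        ∑ p, x p * (G p.1 j).coeff (t + 1 + (p.2 + 1)) := by
      simp only [Matrix.vecMul, dotProduct, Finset.sum_mul, ccfA]
      rw [Finset.sum_comm]
      refine Finset.sum_congr rfl fun p _ => ?_
      simp only [mul_assoc]
      rw [← Finset.mul_sum, sum_ite_mul_coeff G p.1 (p.2 + 1) t j]
      congr 2
      omega
    have hB : ∑ q, ((fun i => (u i).coeff 0) ᵥ* ccfB (rowDeg G)) q *
        (G q.1 j).coeff (t + (q.2 + 1)) = ∑ i, (u i).coeff 0 * (G i j).coeff (t + 1) := by
      simp only [Matrix.vecMul, dotProduct, Finset.sum_mul, ccfB]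
      rw [Finset.sum_comm]
      refine Finset.sum_congr rfl fun i _ => ?_
      simp only [mul_assoc]
      rw [← Finset.mul_sum, sum_ite_mul_coeff G i 0 t j]
    have hu : ∀ i, (u i * G i j).coeff (t + 1) =
        (divX (u i) * G i j).coeff t + (u i).coeff 0 * (G i j).coeff (t + 1) := by
      intro i
      conv_lhs => rw [← X_mul_divX_add (u i)]
      rw [add_mul, mul_assoc, coeff_add, coeff_X_mul, coeff_C_mul]
    simp only [output_apply, Pi.add_apply, coeff_add, coeff_freeOutput, add_mul,
      Finset.sum_add_distrib, hA, hB]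
    simp only [Matrix.vecMul, dotProduct, finsetSum_coeff, hu, Finset.sum_add_distrib]
    ring

lemma divX_output {k n : ℕ} (G : Matrix (Fin k) (Fin n) (Polynomial F))
    (x : StateIdx (rowDeg G) → F) (u : Fin k → F[X]) :
    (fun j => divX (output G (x, u) j)) =
      output G (x ᵥ* ccfA (rowDeg G) + (fun i => (u i).coeff 0) ᵥ* ccfB (rowDeg G),
        fun i => divX (u i)) := by
  ext j t
  rw [coeff_divX, output_eq_step G x u j, coeff_add, coeff_C_succ, add_zero, coeff_X_mul]

/-- The outputs of a realization depend only on the code. -/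
lemma range_output_le {k n : ℕ} {G G' : Matrix (Fin k) (Fin n) (Polynomial F)}
    (h : codeOf G = codeOf G') : LinearMap.range (output G) ≤ LinearMap.range (output G') := by
  have hcode : ∀ u : Fin k → F[X], u ᵥ* G ∈ LinearMap.range (output G') := by
    intro u
    obtain ⟨u', hu'⟩ : u ᵥ* G ∈ codeOf G' := h ▸ ⟨u, rfl⟩
    exact ⟨(0, u'), by rw [output_apply, map_zero, zero_add]; exact hu'⟩
  have hdiv : ∀ v ∈ LinearMap.range (output G'),
      (fun j => divX (v j)) ∈ LinearMap.range (output G') := by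
    rintro _ ⟨⟨x, u⟩, rfl⟩
    exact ⟨_, (divX_output G' x u).symm⟩
  have hiter : ∀ m, ∀ v ∈ LinearMap.range (output G'),
      (fun j => divX^[m] (v j)) ∈ LinearMap.range (output G') := by
    intro m
    induction m with
    | zero => exact fun v hv => hv
    | succ m ih => exact fun v hv => ih _ (hdiv v hv)
  rintro _ ⟨⟨x, u⟩, rfl⟩
  rw [output_apply]
  refine add_mem ?_ (hcode u)
  rw [freeOutput, Fintype.linearCombination_apply]
  refine sum_mem fun p _ => Submodule.smul_mem _ _ (hiter _ _ ?_)
  have := hcode (Pi.single p.1 1)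
  rwa [Matrix.single_one_vecMul] at this

/-- A transition of the controller canonical form, described in terms of the code. -/
lemma exists_transition_iff {k n : ℕ} {G : Matrix (Fin k) (Fin n) (Polynomial F)}
    (hG : HasIndepLeadingRows G) (x y : StateIdx (rowDeg G) → F) (v : Fin n → F) :
    (∃ u : Fin k → F, x ᵥ* ccfA (rowDeg G) + u ᵥ* ccfB (rowDeg G) = y ∧
      x ᵥ* ccfC G + u ᵥ* ccfD G = v) ↔
    (fun j => X * freeOutput G y j + C (v j)) - freeOutput G x ∈ codeOf G := by
  constructor
  · rintro ⟨u, rfl, rfl⟩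
    refine ⟨fun i => C (u i), ?_⟩
    have := output_eq_step G x fun i => C (u i)
    funext j
    specialize this j
    simp only [coeff_C_zero, divX_C] at this
    rw [Pi.sub_apply, eq_sub_iff_add_eq', ← Pi.add_apply, ← output_apply, this, output_apply]
    simp [Matrix.vecMul, dotProduct]
  · rintro ⟨u, hu⟩
    have hstep : ∀ j, X * output G (y, 0) j + C (v j) = output G (x, u) j := by
      intro j
      have := congrFun hu j
      simp only [Pi.sub_apply] at this
      rw [output_apply, output_apply, Matrix.zero_vecMul, add_zero, Pi.add_apply, this]
      ring
    refine ⟨fun i => (u i).coeff 0, ?_, ?_⟩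
    · have : output G (y, 0) = output G
          (x ᵥ* ccfA (rowDeg G) + (fun i => (u i).coeff 0) ᵥ* ccfB (rowDeg G),
            fun i => divX (u i)) := by
        rw [← divX_output]
        ext j t
        rw [← hstep, coeff_divX, coeff_add, coeff_C_succ, add_zero, coeff_X_mul]
      exact (congrArg Prod.fst (output_injective hG this)).symm
    · ext j
      have := congrArg (fun p => p.coeff 0) ((hstep j).trans (output_eq_step G x u j))
      simpa using this.symm

lemma WAMe_eq_ncard_outputs {k n : ℕ} [DecidableEq F]
    {G : Matrix (Fin k) (Fin n) (Polynomial F)} (hG : HasIndepLeadingRows G)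
    (x y : StateIdx (rowDeg G) → F) (w : ℕ) :
    WAMe G x y w = Set.ncard {v : Fin n → F |
      (fun j => X * freeOutput G y j + C (v j)) - freeOutput G x ∈ codeOf G ∧
        hammingNorm v = w} := by
  have himage : {v : Fin n → F |
      (fun j => X * freeOutput G y j + C (v j)) - freeOutput G x ∈ codeOf G ∧
        hammingNorm v = w} = (fun u : Fin k → F => x ᵥ* ccfC G + u ᵥ* ccfD G) ''
      {u | x ᵥ* ccfA (rowDeg G) + u ᵥ* ccfB (rowDeg G) = y ∧
        hammingNorm (x ᵥ* ccfC G + u ᵥ* ccfD G) = w} := by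
    ext v
    rw [Set.mem_ofPred_eq, ← exists_transition_iff hG]
    constructor
    · rintro ⟨⟨u, h1, rfl⟩, h2⟩
      exact ⟨u, ⟨h1, h2⟩, rfl⟩
    · rintro ⟨u, ⟨h1, h2⟩, rfl⟩
      exact ⟨⟨u, h1, rfl⟩, h2⟩
  rw [himage, Set.InjOn.ncard_image, WAMe]
  rintro u ⟨hu, -⟩ u' ⟨hu', -⟩ huu'
  have : output G (x, fun i => C (u i)) = output G (x, fun i => C (u' i)) := by
    funext j
    rw [output_eq_step G x fun i => C (u i), output_eq_step G x fun i => C (u' i)]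
    simp only [coeff_C_zero, divX_C]
    simp only at huu'
    rw [huu', hu, hu']
  have := congrArg Prod.snd (output_injective hG this)
  funext i
  exact C_injective (congrFun this i)

/-- Realizations of the same code have isomorphic state spaces, compatibly with the zero-input
outputs modulo the code. -/
lemma exists_state_equiv {k n : ℕ} {G G' : Matrix (Fin k) (Fin n) (Polynomial F)}
    (hG : HasIndepLeadingRows G) (hG' : HasIndepLeadingRows G') (h : codeOf G = codeOf G') :
    ∃ T : (StateIdx (rowDeg G) → F) ≃ₗ[F] (StateIdx (rowDeg G') → F),
      ∀ x, freeOutput G' (T x) - freeOutput G x ∈ codeOf G := by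
  have key : ∀ {G G' : Matrix (Fin k) (Fin n) (Polynomial F)}, codeOf G = codeOf G' →
      ∀ x, ∃ x', freeOutput G' x' - freeOutput G x ∈ codeOf G := by
    intro G G' h x
    obtain ⟨⟨x', u⟩, hx⟩ := range_output_le h ⟨(x, 0), rfl⟩
    refine ⟨x', h ▸ ⟨-u, ?_⟩⟩
    rw [output_apply, output_apply, Matrix.zero_vecMul, add_zero] at hx
    simp only [← hx, Matrix.neg_vecMul]
    abel
  have uniq : ∀ {G : Matrix (Fin k) (Fin n) (Polynomial F)}, HasIndepLeadingRows G →
      ∀ x y, freeOutput G x - freeOutput G y ∈ codeOf G → x = y := by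
    rintro G hG x y ⟨u, hu⟩
    have : output G (x, 0) = output G (y, u) := by
      rw [output_apply, output_apply, Matrix.zero_vecMul, add_zero]
      simp only at hu
      rw [hu]
      abel
    exact congrArg Prod.fst (output_injective hG this)
  obtain ⟨S, hS⟩ : ∃ S : Submodule F (Fin n → F[X]), ∀ v, v ∈ codeOf G ↔ v ∈ S :=
    ⟨LinearMap.range ((Matrix.vecMulLinear G).restrictScalars F), fun v => Iff.rfl⟩
  choose f hf using key h
  choose g hg using key h.symm
  simp only [← h, hS] at hf hg
  have uniq' : ∀ x y, freeOutput G' x - freeOutput G' y ∈ S → x = y := fun x y hxy =>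
    uniq hG' x y (h ▸ (hS _).2 hxy)
  refine ⟨⟨⟨⟨f, ?_⟩, ?_⟩, g, ?_, ?_⟩, fun x => (hS _).2 (hf x)⟩
  · intro x y
    apply uniq'
    convert sub_mem (hf (x + y)) (add_mem (hf x) (hf y)) using 1
    simp only [map_add]
    abel
  · intro c x
    apply uniq'
    convert sub_mem (hf (c • x)) (S.smul_mem c (hf x)) using 1
    simp only [map_smul, RingHom.id_apply, smul_sub]
    abel
  · intro x
    refine uniq hG _ _ ((hS _).2 ?_)
    convert add_mem (hg (f x)) (hf x) using 1
    simp
  · intro x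
    apply uniq'
    convert add_mem (hf (g x)) (hg x) using 1
    simp

/-- The weight adjacency matrix of a convolutional code is unique up to a state
space isomorphism: for any two basic reduced encoders of the same code of degree `δ`
there is a state space isomorphism `T` with `Λ(G)_{X,Y} = Λ(Ḡ)_{XT,YT}`. -/
theorem stmt11 {F : Type*} [Field F] [Fintype F] [DecidableEq F] {k n δ : ℕ}
    (C : Submodule (Polynomial F) (Fin n → Polynomial F))
    (G Gbar : Matrix (Fin k) (Fin n) (Polynomial F))
    (hG : IsBasic G) (hGred : IsRowReduced G)
    (hCG : (C : Set (Fin n → Polynomial F)) = codeOf G)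
    (hGbar : IsBasic Gbar) (hGbarred : IsRowReduced Gbar)
    (hCGbar : (C : Set (Fin n → Polynomial F)) = codeOf Gbar)
    (hdG : degMat G = δ) (hdGbar : degMat Gbar = δ) :
    ∃ T : (StateIdx (rowDeg G) → F) ≃ₗ[F] (StateIdx (rowDeg Gbar) → F),
      ∀ (X Y : StateIdx (rowDeg G) → F) (w : ℕ),
        WAMe G X Y w = WAMe Gbar (T X) (T Y) w := by
  have hL := hasIndepLeadingRows_of_isBasic hG hGred
  have hLbar := hasIndepLeadingRows_of_isBasic hGbar hGbarred
  have hcode : codeOf G = codeOf Gbar := hCG.symm.trans hCGbar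
  obtain ⟨T, hT⟩ := exists_state_equiv hL hLbar hcode
  refine ⟨T, fun x y w => ?_⟩
  rw [WAMe_eq_ncard_outputs hL, WAMe_eq_ncard_outputs hLbar, ← hcode]
  simp only [← hCG, SetLike.mem_coe] at hT ⊢
  congr 1
  ext v
  refine and_congr_left fun _ => ?_
  have hdiff := sub_mem (C.smul_mem (Polynomial.X : F[X]) (hT y)) (hT x)
  rw [← C.add_mem_iff_left hdiff]
  convert Iff.rfl using 2
  funext j
  simp only [Pi.add_apply, Pi.sub_apply, Pi.smul_apply, smul_eq_mul]
  ring
end
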